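/- arXiv:2410.12455 — 3 statements merged into one kernel-verified Lean document; each statement's English description precedes it below -/
import Mathlib

section
/- Example (two-layer ReLU network with logistic loss and L2 regularization): Fix data (x_i, y_i), i = 1,…,n, with x_i ∈ ℝ^d and y_i ∈ {−1, +1}, and λ_1, λ_2 > 0. Let φ(t) := log(1 + exp(−t)), σ the coordinatewise ReLU σ(t) = max(t,0), and for W ∈ ℝ^{k×d}, v ∈ ℝ^k define f_i(W,v) := φ(y_i · vᵀσ(W x_i)) + λ_1‖v‖² + λ_2‖W‖_F², f := (1/n)∑_{i=1}^n f_i, f_i* := inf f_i. Define the (almost-everywhere) gradient map g_i(W,v) := ( φ′(y_i vᵀσ(W x_i))·y_i·(v ∘ e_W)x_iᵀ + 2λ_2 W , φ′(y_i vᵀσ(W x_i))·y_i·((W x_i) ∘ e_W) + 2λ_1 v ), where e_W := 1_{W x_i ≥ 0} ∈ {0,1}^k is the coordinatewise indicator and ∘ is the coordinatewise product. Assume 𝒮 := argmin f is nonempty and compact with inf_{(Z,z)∈𝒮} f_i(Z,z) > f_i* for every i, and let 𝒳 be any bounded set containing 𝒮. Then there exists α ≥ 1 such that, with β = α − 1,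 for every (W,v) ∈ 𝒳, every (Z,z) ∈ 𝒮, and every i ∈ [n]: ⟨g_i(W,v), (W − Z, v − z)⟩ ≥ α(f_i(W,v) − f_i(Z,z)) − β(f_i(W,v) − f_i*). -/
open scoped BigOperators

/-- Example (two-layer ReLU network with logistic loss and L2 regularization):
the α-β-condition holds with β = α − 1 on any bounded set 𝒳 containing the
compact minimizer set 𝒮, with the explicit (a.e.) gradient map `g_i = (gW i, gv i)`.
A point of the parameter space is a pair `p = (W, v)` with
`W : Fin k → Fin d → ℝ` and `v : Fin k → ℝ`. -/
theorem two_layer_relu_abc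
    {n k d : ℕ} (hn : 0 < n)
    (xs : Fin n → Fin d → ℝ) (ys : Fin n → ℝ)
    (hy : ∀ i, ys i = 1 ∨ ys i = -1)
    (l1 l2 : ℝ) (hl1 : 0 < l1) (hl2 : 0 < l2)
    (φ φ' : ℝ → ℝ)
    (hφ : φ = fun t => Real.log (1 + Real.exp (-t)))
    (hφ' : φ' = fun t => -Real.exp (-t) / (1 + Real.exp (-t)))
    (pre : Fin n → (Fin k → Fin d → ℝ) × (Fin k → ℝ) → Fin k → ℝ)
    (hpre : pre = fun i p a => ∑ b, p.1 a b * xs i b)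
    (ind : Fin n → (Fin k → Fin d → ℝ) × (Fin k → ℝ) → Fin k → ℝ)
    (hind : ind = fun i p a => if 0 ≤ pre i p a then 1 else 0)
    (sc : Fin n → (Fin k → Fin d → ℝ) × (Fin k → ℝ) → ℝ)
    (hsc : sc = fun i p => ys i * ∑ a, p.2 a * max (pre i p a) 0)
    (fi : Fin n → (Fin k → Fin d → ℝ) × (Fin k → ℝ) → ℝ)
    (hfi : fi = fun i p =>
      φ (sc i p) + l1 * ∑ a, (p.2 a) ^ 2 + l2 * ∑ a, ∑ b, (p.1 a b) ^ 2)
    (f : (Fin k → Fin d → ℝ) × (Fin k → ℝ) → ℝ)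
    (hf : f = fun p => (1 / (n : ℝ)) * ∑ i, fi i p)
    (Fstar : Fin n → ℝ) (hFstar : ∀ i, Fstar i = ⨅ p, fi i p)
    (gW : Fin n → (Fin k → Fin d → ℝ) × (Fin k → ℝ) → Fin k → Fin d → ℝ)
    (hgW : gW = fun i p a b =>
      φ' (sc i p) * ys i * (p.2 a * ind i p a) * xs i b + 2 * l2 * p.1 a b)
    (gv : Fin n → (Fin k → Fin d → ℝ) × (Fin k → ℝ) → Fin k → ℝ)
    (hgv : gv = fun i p a =>
      φ' (sc i p) * ys i * (pre i p a * ind i p a) + 2 * l1 * p.2 a)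
    (Smin : Set ((Fin k → Fin d → ℝ) × (Fin k → ℝ)))
    (hSmin : Smin = {p | ∀ q, f p ≤ f q})
    (hSne : Smin.Nonempty) (hScpt : IsCompact Smin)
    (hgap : ∀ i, Fstar i < sInf (fi i '' Smin))
    (𝒳 : Set ((Fin k → Fin d → ℝ) × (Fin k → ℝ)))
    (hsub : Smin ⊆ 𝒳)
    (hbound : ∃ R : ℝ, ∀ p ∈ 𝒳,
      (∑ a, ∑ b, (p.1 a b) ^ 2) ≤ R ∧ (∑ a, (p.2 a) ^ 2) ≤ R) :
    ∃ α : ℝ, 1 ≤ α ∧ ∀ p ∈ 𝒳, ∀ q ∈ Smin, ∀ i,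
      α * (fi i p - fi i q) - (α - 1) * (fi i p - Fstar i)
        ≤ (∑ a, ∑ b, gW i p a b * (p.1 a b - q.1 a b))
          + ∑ a, gv i p a * (p.2 a - q.2 a) := by
  obtain ⟨R, hR⟩ := hbound
  have hφnn : ∀ t, 0 ≤ φ t := by
    intro t
    rw [hφ]
    exact Real.log_nonneg (by linarith [Real.exp_pos (-t)])
  have hfnn : ∀ i p, 0 ≤ fi i p := by
    intro i p
    have h1 := hφnn (sc i p)
    rw [hfi]
    have h2 : 0 ≤ l1 * ∑ a, (p.2 a) ^ 2 := by positivity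
    have h3 : 0 ≤ l2 * ∑ a, ∑ b, (p.1 a b) ^ 2 := by positivity
    simp only
    linarith
  have hge : ∀ i, ∀ q ∈ Smin, sInf (fi i '' Smin) ≤ fi i q := by
    intro i q hq
    apply csInf_le
    · refine ⟨0, ?_⟩
      rintro _ ⟨p, _, rfl⟩
      exact hfnn i p
    · exact ⟨q, hq, rfl⟩
  have hsq : ∀ x : ℝ, x ^ 2 ≤ R → -(R + 1) ≤ x ∧ x ≤ R + 1 := by
    intro x hx
    constructor <;> nlinarith [sq_nonneg (x - 1), sq_nonneg (x + 1)]
  let K : Set ((Fin k → Fin d → ℝ) × (Fin k → ℝ)) :=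
    Set.Icc (fun _ _ => -(R + 1), fun _ => -(R + 1)) (fun _ _ => R + 1, fun _ => R + 1)
  have hK : ∀ p ∈ 𝒳, p ∈ K := by
    intro p hp
    obtain ⟨h1, h2⟩ := hR p hp
    have hW : ∀ a b, (p.1 a b) ^ 2 ≤ R := by
      intro a b
      refine le_trans ?_ h1
      refine le_trans (Finset.single_le_sum (f := fun b => (p.1 a b) ^ 2)
        (fun b _ => sq_nonneg _) (Finset.mem_univ b)) ?_
      exact Finset.single_le_sum (f := fun a => ∑ b, (p.1 a b) ^ 2)
        (fun a _ => Finset.sum_nonneg (fun b _ => sq_nonneg _)) (Finset.mem_univ a)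
    have hv : ∀ a, (p.2 a) ^ 2 ≤ R := by
      intro a
      refine le_trans ?_ h2
      exact Finset.single_le_sum (f := fun a => (p.2 a) ^ 2)
        (fun a _ => sq_nonneg _) (Finset.mem_univ a)
    exact ⟨⟨fun a b => (hsq _ (hW a b)).1, fun a => (hsq _ (hv a)).1⟩,
      ⟨fun a b => (hsq _ (hW a b)).2, fun a => (hsq _ (hv a)).2⟩⟩
  have hKc : IsCompact K := isCompact_Icc
  have hEc : IsCompact (Set.Icc (0 : Fin k → ℝ) 1) := isCompact_Icc
  have hprec : ∀ i, Continuous (pre i) := by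
    intro i; rw [hpre]; fun_prop
  have hscc : ∀ i, Continuous (sc i) := by
    intro i
    have := hprec i
    rw [hsc]; fun_prop
  have hφc : Continuous φ := by
    rw [hφ]
    refine Continuous.log (by fun_prop) ?_
    intro t; positivity
  have hφ'c : Continuous φ' := by
    rw [hφ']
    refine Continuous.div (by fun_prop) (by fun_prop) ?_
    intro t; positivity
  have hfic : ∀ i, Continuous (fi i) := by
    intro i
    have := hscc i
    rw [hfi]; fun_prop
  have hC : ∀ i, ∃ C : ℝ, ∀ p ∈ 𝒳, ∀ q ∈ Smin, fi i p - fi i q -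
      ((∑ a, ∑ b, gW i p a b * (p.1 a b - q.1 a b)) + ∑ a, gv i p a * (p.2 a - q.2 a)) ≤ C := by
    intro i
    have h1 := hprec i
    have h2 := hscc i
    have h3 := hfic i
    let H : ((Fin k → Fin d → ℝ) × (Fin k → ℝ)) × ((Fin k → Fin d → ℝ) × (Fin k → ℝ)) ×
        (Fin k → ℝ) → ℝ := fun z => fi i z.1 - fi i z.2.1 -
      ((∑ a, ∑ b, (φ' (sc i z.1) * ys i * (z.1.2 a * z.2.2 a) * xs i b + 2 * l2 * z.1.1 a b)
          * (z.1.1 a b - z.2.1.1 a b))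
        + ∑ a, (φ' (sc i z.1) * ys i * (pre i z.1 a * z.2.2 a) + 2 * l1 * z.1.2 a)
          * (z.1.2 a - z.2.1.2 a))
    have hH : Continuous H := by fun_prop
    obtain ⟨C, hC⟩ := (hKc.prod (hKc.prod hEc)).exists_bound_of_continuousOn hH.continuousOn
    refine ⟨C, fun p hp q hq => ?_⟩
    have hz : (p, q, ind i p) ∈ K ×ˢ (K ×ˢ Set.Icc (0 : Fin k → ℝ) 1) := by
      refine ⟨hK p hp, hK q (hsub hq), ?_⟩
      rw [hind]
      constructor <;> intro a <;> simp only [Pi.zero_apply, Pi.one_apply] <;> split_ifs <;> norm_num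
    have h := le_trans (le_abs_self _) (hC _ hz)
    rw [hgW, hgv]
    exact h
  choose C hC using hC
  have hd : ∀ i, 0 < sInf (fi i '' Smin) - Fstar i := fun i => sub_pos.2 (hgap i)
  have hnn : ∀ i, 0 ≤ |C i| / (sInf (fi i '' Smin) - Fstar i) :=
    fun i => div_nonneg (abs_nonneg _) (hd i).le
  refine ⟨1 + ∑ i, |C i| / (sInf (fi i '' Smin) - Fstar i), ?_, ?_⟩
  · linarith [Finset.sum_nonneg (fun i (_ : i ∈ Finset.univ) => hnn i)]
  intro p hp q hq i
  have h1 := hC i p hp q hq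
  have h2 := Finset.single_le_sum (fun i _ => hnn i) (Finset.mem_univ i)
  have h3 := hge i q hq
  have h4 : |C i| ≤ (∑ i, |C i| / (sInf (fi i '' Smin) - Fstar i)) * (fi i q - Fstar i) := by
    calc |C i| = |C i| / (sInf (fi i '' Smin) - Fstar i) * (sInf (fi i '' Smin) - Fstar i) :=
          (div_mul_cancel₀ _ (hd i).ne').symm
      _ ≤ _ := mul_le_mul h2 (by linarith) (hd i).le ((hnn i).trans h2)
  have h5 := le_abs_self (C i)
  linarith
end

section
/- NGN descent inequality (Lemma D.3): Let f_i : ℝ^d → ℝ be differentiable, nonnegative, and L-smooth (‖∇f_i(x) − ∇f_i(y)‖ ≤ L‖x − y‖ for all x,y, L > 0), with f_i* := inf f_i ≥ 0, let γ > 0, and let x ∈ ℝ^d with f_i(x) > 0. Define γ_k := γ/(1 + (γ/(2 f_i(x)))·‖∇f_i(x)‖²). Then γ_k²·‖∇f_i(x)‖² ≤ (4γL/(1 + 2γL))·γ_k·(f_i(x) − f_i*) + (2γ²L/(1 + γL))·max{ (2γL − 1)/(2γL + 1), 0 }·f_i*. -/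
open scoped RealInnerProductSpace


lemma ngn_core_poly (a u r c : ℝ) (ha : 0 < a) (hu : 0 ≤ u) (hr : 0 ≤ r)
    (h : u ≤ a * (1 - r)) (hc : c = max (2 * a - 1) 0) :
    u * (1 + 2 * a) * (1 + a) ≤ 2 * a * (1 + a) * (1 - r) * (1 + u)
      + a * c * r * (1 + u) ^ 2 := by
  have har : 0 ≤ a * r := mul_nonneg ha.le hr
  have hua : 0 ≤ a - u := by nlinarith
  have key : 0 ≤ (1 + a) * (2 * a - u)
      + (a - u) * (c * (1 + u) ^ 2 - 2 * (1 + a) * (1 + u)) := by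
    rcases le_total (2 * a - 1) 0 with h1 | h1
    · rw [max_eq_right h1] at hc
      subst hc
      have : 0 ≤ (1 + a) * (u * ((1 - 2 * a) + 2 * u)) := by
        have : 0 ≤ 1 - 2 * a := by linarith
        positivity
      nlinarith
    · rw [max_eq_left h1] at hc
      subst hc
      refine le_of_mul_le_mul_left (a := a) ?_ ha
      rw [mul_zero]
      have : 0 ≤ (2 * a - 1) * (a - u) * ((a - u) + a * u + a * u ^ 2)
          + (1 + a) * u * u := by positivity
      linarith
  have e : 2 * a * (1 + a) * (1 - r) * (1 + u) + a * c * r * (1 + u) ^ 2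
      - u * (1 + 2 * a) * (1 + a)
      = (1 + a) * (2 * a - u) + (a * r) * (c * (1 + u) ^ 2 - 2 * (1 + a) * (1 + u)) := by
    ring
  have h0 : 0 ≤ (1 + a) * (2 * a - u) := mul_nonneg (by linarith) (by linarith)
  have hle : a * r ≤ a - u := by linarith
  generalize c * (1 + u) ^ 2 - 2 * (1 + a) * (1 + u) = S at *
  rcases le_total 0 S with hS | hS
  · have := mul_nonneg har hS
    linarith
  · have := mul_le_mul_of_nonpos_right hle hS
    linarith

lemma ngn_grad_bound {d : ℕ} (f : EuclideanSpace ℝ (Fin d) → ℝ)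
    (hdiff : Differentiable ℝ f) (L : ℝ) (hL : 0 < L)
    (hsmooth : ∀ x y : EuclideanSpace ℝ (Fin d),
      ‖gradient f x - gradient f y‖ ≤ L * ‖x - y‖)
    (x : EuclideanSpace ℝ (Fin d)) :
    f (x - (1 / L) • gradient f x) ≤ f x - ‖gradient f x‖ ^ 2 / (2 * L) := by
  set g := gradient f x with hg
  have hd : ∀ t : ℝ, HasDerivAt (fun t : ℝ => f (x - t • g) + t * ‖g‖ ^ 2 - L * t ^ 2 / 2 * ‖g‖ ^ 2)
      (-(inner ℝ (gradient f (x - t • g)) g) + ‖g‖ ^ 2 - L * t * ‖g‖ ^ 2) t := by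
    intro t
    have h1 : HasDerivAt (fun t : ℝ => x - t • g) (-g) t := by
      simpa using ((hasDerivAt_id t).smul_const g).const_sub x
    have h2 := ((hdiff (x - t • g)).hasGradientAt.hasFDerivAt).comp_hasDerivAt t h1
    have h3 := (h2.add ((hasDerivAt_id t).mul_const (‖g‖ ^ 2))).sub
      ((((hasDerivAt_id t).pow 2).const_mul (L / 2)).mul_const (‖g‖ ^ 2))
    have e1 : (fun t : ℝ => f (x - t • g) + t * ‖g‖ ^ 2 - L * t ^ 2 / 2 * ‖g‖ ^ 2)
        = (((f ∘ fun t : ℝ => x - t • g) + fun y : ℝ => id y * ‖g‖ ^ 2)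
          - fun y : ℝ => L / 2 * ((id : ℝ → ℝ) ^ 2) y * ‖g‖ ^ 2) := by
      funext s
      simp
      left
      ring
    rw [e1]
    refine h3.congr_deriv ?_
    simp
    left
    ring
  have hanti : AntitoneOn
      (fun t : ℝ => f (x - t • g) + t * ‖g‖ ^ 2 - L * t ^ 2 / 2 * ‖g‖ ^ 2) (Set.Ici 0) := by
    apply antitoneOn_of_deriv_nonpos (convex_Ici 0)
    · exact fun t _ => (hd t).continuousAt.continuousWithinAt
    · exact fun t _ => (hd t).differentiableAt.differentiableWithinAt
    · intro t ht
      rw [interior_Ici] at ht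
      have ht' : 0 < t := ht
      rw [(hd t).deriv]
      have h1 : inner ℝ (g - gradient f (x - t • g)) g
          = ‖g‖ ^ 2 - inner ℝ (gradient f (x - t • g)) g := by
        rw [inner_sub_left, real_inner_self_eq_norm_sq]
      have h2 := real_inner_le_norm (g - gradient f (x - t • g)) g
      have h3 := hsmooth x (x - t • g)
      rw [← hg, sub_sub_cancel, norm_smul, Real.norm_eq_abs, abs_of_pos ht'] at h3
      have h4 := mul_le_mul_of_nonneg_right h3 (norm_nonneg g)
      nlinarith
  have h := hanti (Set.mem_Ici.2 le_rfl) (Set.mem_Ici.2 (one_div_pos.2 hL).le)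
    (one_div_pos.2 hL).le
  simp only [zero_smul, sub_zero] at h
  have e : 1 / L * ‖g‖ ^ 2 - L * (1 / L) ^ 2 / 2 * ‖g‖ ^ 2 = ‖g‖ ^ 2 / (2 * L) := by
    field_simp
    ring
  norm_num at h e ⊢
  linarith

/-- NGN descent inequality (Lemma D.3). -/
theorem ngn_descent_inequality
    {d : ℕ} (f : EuclideanSpace ℝ (Fin d) → ℝ)
    (hdiff : Differentiable ℝ f)
    (hnonneg : ∀ x, 0 ≤ f x)
    (L : ℝ) (hL : 0 < L)
    (hsmooth : ∀ x y : EuclideanSpace ℝ (Fin d),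
      ‖gradient f x - gradient f y‖ ≤ L * ‖x - y‖)
    (fstar : ℝ) (hfstar : fstar = ⨅ x, f x)
    (γ : ℝ) (hγ : 0 < γ)
    (x : EuclideanSpace ℝ (Fin d)) (hfx : 0 < f x)
    (γk : ℝ) (hγk : γk = γ / (1 + γ / (2 * f x) * ‖gradient f x‖ ^ 2)) :
    γk ^ 2 * ‖gradient f x‖ ^ 2
      ≤ 4 * γ * L / (1 + 2 * γ * L) * γk * (f x - fstar)
        + 2 * γ ^ 2 * L / (1 + γ * L)
          * max ((2 * γ * L - 1) / (2 * γ * L + 1)) 0 * fstar := by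
  have hbdd : BddBelow (Set.range f) := ⟨0, by rintro _ ⟨y, rfl⟩; exact hnonneg y⟩
  have hs0 : 0 ≤ fstar := by rw [hfstar]; exact Real.iInf_nonneg hnonneg
  have hG : ‖gradient f x‖ ^ 2 ≤ 2 * L * (f x - fstar) := by
    have h1 := ngn_grad_bound f hdiff L hL hsmooth x
    have h2 : fstar ≤ f (x - (1 / L) • gradient f x) := by
      rw [hfstar]; exact ciInf_le hbdd _
    have h3 : ‖gradient f x‖ ^ 2 / (2 * L) ≤ f x - fstar := by linarith
    rw [div_le_iff₀ (by positivity)] at h3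
    linarith
  have hG0 : 0 ≤ ‖gradient f x‖ ^ 2 := by positivity
  generalize ‖gradient f x‖ ^ 2 = G at *
  generalize f x = F at *
  obtain ⟨u, hu⟩ : ∃ u, u = γ / (2 * F) * G := ⟨_, rfl⟩
  obtain ⟨r, hr⟩ : ∃ r, r = fstar / F := ⟨_, rfl⟩
  have hu0 : 0 ≤ u := by rw [hu]; positivity
  have hr0 : 0 ≤ r := by rw [hr]; positivity
  have hGu : G = 2 * F * u / γ := by rw [hu]; field_simp
  have hsr : fstar = F * r := by rw [hr]; field_simp
  have hle : u ≤ (γ * L) * (1 - r) := by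
    rw [hGu, hsr, div_le_iff₀ hγ] at hG
    have : (2 * F) * u ≤ (2 * F) * (γ * L * (1 - r)) := by linarith
    exact le_of_mul_le_mul_left this (by positivity)
  rw [← hu] at hγk
  have ha : 0 < γ * L := by positivity
  have core := ngn_core_poly (γ * L) u r _ ha hu0 hr0 hle rfl
  have hm : max ((2 * γ * L - 1) / (2 * γ * L + 1)) 0
      = max (2 * (γ * L) - 1) 0 / (1 + 2 * (γ * L)) := by
    rw [← max_div_div_right (by positivity), zero_div]
    congr 2 <;> ring
  rw [hm]
  generalize max (2 * (γ * L) - 1) 0 = c at *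
  rw [hγk, hGu, hsr, ← sub_nonneg]
  have e : 4 * γ * L / (1 + 2 * γ * L) * (γ / (1 + u)) * (F - F * r)
      + 2 * γ ^ 2 * L / (1 + γ * L) * (c / (1 + 2 * (γ * L))) * (F * r)
      - (γ / (1 + u)) ^ 2 * (2 * F * u / γ)
      = 2 * γ * F / ((1 + 2 * (γ * L)) * (1 + γ * L) * (1 + u) ^ 2)
        * (2 * (γ * L) * (1 + γ * L) * (1 - r) * (1 + u)
      + γ * L * c * r * (1 + u) ^ 2 - u * (1 + 2 * (γ * L)) * (1 + γ * L)) := by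
    have h1 : 1 + γ * L ≠ 0 := by positivity
    have h2 : 1 + 2 * (γ * L) ≠ 0 := by positivity
    have h2' : 1 + 2 * γ * L ≠ 0 := by positivity
    have h3 : 1 + u ≠ 0 := by positivity
    rw [show 1 + 2 * γ * L = 1 + 2 * (γ * L) by ring]
    field_simp
    ring
  rw [e]
  exact mul_nonneg (by positivity) (sub_nonneg.2 core)
end

section
/- DecSPS stepsize bounds (Lemma): Let each f_i : ℝ^d → ℝ be differentiable, L-smooth (L > 0) with finite f_i* := inf f_i. Let {c_k}_{k ≥ 0} be any non-decreasing positive sequence with c_{−1} := c_0, let γ_{−1} := γ_b > 0, fix any starting point x^0 and index sequence (i_k), and define recursively γ_k := (1/c_k)·min{ (f_{i_k}(x^k) − f_{i_k}*)/‖∇f_{i_k}(x^k)‖², c_{k−1}γ_{k−1} } and x^{k+1} := x^k − γ_k ∇f_{i_k}(x^k), assuming ∇f_{i_k}(x^k) ≠ 0 at every iteration. Then for all k ≥ 0: min{ 1/(2 c_k L), c_0 γ_b / c_k } ≤ γ_k ≤ c_0 γ_b / c_k, and γ_k ≤ γ_{k−1}. -/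
open scoped RealInnerProductSpace BigOperators

theorem decsps_aux {d : ℕ} (f : EuclideanSpace ℝ (Fin d) → ℝ) (hf : Differentiable ℝ f)
    (hb : BddBelow (Set.range f)) (L : ℝ) (hL : 0 < L)
    (hs : ∀ x y : EuclideanSpace ℝ (Fin d), ‖gradient f x - gradient f y‖ ≤ L * ‖x - y‖)
    (x : EuclideanSpace ℝ (Fin d)) (hg : gradient f x ≠ 0) :
    1 / (2 * L) ≤ (f x - ⨅ y, f y) / ‖gradient f x‖ ^ 2 := by
  set g := gradient f x with hgdef
  have hgp : 0 < ‖g‖ := norm_pos_iff.mpr hg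
  have hder : ∀ t : ℝ, HasDerivAt (fun t : ℝ => f (x - t • g) + t * ‖g‖ ^ 2 - L * t ^ 2 / 2 * ‖g‖ ^ 2)
      (inner ℝ (gradient f (x - t • g)) (-g) + ‖g‖ ^ 2 - L * t * ‖g‖ ^ 2) t := by
    intro t
    have h1 : HasFDerivAt f _ (x - t • g) := (hf (x - t • g)).hasGradientAt.hasFDerivAt
    have h2 : HasDerivAt (fun t : ℝ => x - t • g) (-g) t := by
      have := ((hasDerivAt_id t).smul_const g).const_sub x
      simpa using this
    have h3 := h1.comp_hasDerivAt t h2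
    have h4 : HasDerivAt (fun t : ℝ => t * ‖g‖ ^ 2) (‖g‖ ^ 2) t := by
      simpa using (hasDerivAt_id t).mul_const (‖g‖ ^ 2)
    have h5 : HasDerivAt (fun t : ℝ => L * t ^ 2 / 2 * ‖g‖ ^ 2) (L * t * ‖g‖ ^ 2) t := by
      have := ((((hasDerivAt_id t).pow 2).const_mul L).div_const 2).mul_const (‖g‖ ^ 2)
      refine this.congr_deriv ?_
      simp only [id]
      push_cast
      ring
    have h6 := (h3.add h4).sub h5
    refine HasDerivAt.congr_deriv h6 ?_
    rw [InnerProductSpace.toDual_apply_apply]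
  have hanti := antitoneOn_of_deriv_nonpos (convex_Ici (0:ℝ))
    (fun t _ => (hder t).continuousAt.continuousWithinAt)
    (fun t _ => (hder t).differentiableAt.differentiableWithinAt) (by
      intro t ht
      rw [interior_Ici, Set.mem_Ioi] at ht
      rw [(hder t).deriv]
      have e : inner ℝ (gradient f (x - t • g)) (-g) + ‖g‖ ^ 2
          = inner ℝ (g - gradient f (x - t • g)) g := by
        rw [inner_sub_left, inner_neg_right, real_inner_self_eq_norm_sq]; ring
      have h1 := real_inner_le_norm (g - gradient f (x - t • g)) g
      have h2 := hs x (x - t • g)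
      rw [← hgdef, sub_sub_cancel, norm_smul, Real.norm_of_nonneg ht.le] at h2
      rw [e]
      nlinarith [mul_le_mul_of_nonneg_right h2 hgp.le])
  have hL' : (0:ℝ) ≤ 1 / L := by positivity
  have h := hanti (Set.mem_Ici.2 le_rfl) (Set.mem_Ici.2 hL') hL'
  have hi : (⨅ y, f y) ≤ f (x - (1 / L) • g) := ciInf_le hb _
  simp only [zero_smul, sub_zero] at h
  rw [le_div_iff₀ (by positivity)]
  have e : 1 / L * ‖g‖ ^ 2 - L * (1 / L) ^ 2 / 2 * ‖g‖ ^ 2 = 1 / (2 * L) * ‖g‖ ^ 2 := by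
    field_simp
    ring
  norm_num at h e hi ⊢
  linarith

/-- DecSPS stepsize bounds along any trajectory:
`min{1/(2 c_k L), c₀γ_b/c_k} ≤ γ_k ≤ c₀γ_b/c_k`, and the stepsizes are
non-increasing (with `γ_{−1} = γ_b`). -/
theorem decsps_stepsize_bounds
    {d n : ℕ} (hn : 0 < n)
    (F : Fin n → EuclideanSpace ℝ (Fin d) → ℝ)
    (hdiff : ∀ i, Differentiable ℝ (F i))
    (hbdd : ∀ i, BddBelow (Set.range (F i)))
    (Fstar : Fin n → ℝ) (hFstar : ∀ i, Fstar i = ⨅ x, F i x)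
    (L : ℝ) (hL : 0 < L)
    (hsmooth : ∀ i (x y : EuclideanSpace ℝ (Fin d)),
      ‖gradient (F i) x - gradient (F i) y‖ ≤ L * ‖x - y‖)
    (c : ℕ → ℝ) (hcpos : ∀ k, 0 < c k) (hcmono : Monotone c)
    (γb : ℝ) (hγb : 0 < γb)
    (x0 : EuclideanSpace ℝ (Fin d)) (ω : ℕ → Fin n)
    (x : ℕ → EuclideanSpace ℝ (Fin d)) (γs : ℕ → ℝ)
    (hx0 : x 0 = x0)
    (hgrad : ∀ k, gradient (F (ω k)) (x k) ≠ 0)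
    (hγs0 : γs 0
      = (1 / c 0)
        * min ((F (ω 0) (x 0) - Fstar (ω 0)) / ‖gradient (F (ω 0)) (x 0)‖ ^ 2)
            (c 0 * γb))
    (hγs : ∀ k, γs (k + 1)
      = (1 / c (k + 1))
        * min ((F (ω (k + 1)) (x (k + 1)) - Fstar (ω (k + 1)))
              / ‖gradient (F (ω (k + 1))) (x (k + 1))‖ ^ 2)
            (c k * γs k))
    (hstep : ∀ k, x (k + 1) = x k - γs k • gradient (F (ω k)) (x k)) :
    (∀ k, min (1 / (2 * c k * L)) (c 0 * γb / c k) ≤ γs k ∧ γs k ≤ c 0 * γb / c k) ∧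
    γs 0 ≤ γb ∧ (∀ k, γs (k + 1) ≤ γs k) := by
  have hq : ∀ k, 1 / (2 * L) ≤ (F (ω k) (x k) - Fstar (ω k)) / ‖gradient (F (ω k)) (x k)‖ ^ 2 := by
    intro k
    rw [hFstar]
    exact decsps_aux _ (hdiff _) (hbdd _) L hL (hsmooth _) _ (hgrad k)
  have ha0 : c 0 * γs 0 = min ((F (ω 0) (x 0) - Fstar (ω 0)) / ‖gradient (F (ω 0)) (x 0)‖ ^ 2)
            (c 0 * γb) := by
    rw [hγs0, ← mul_assoc, mul_one_div_cancel (hcpos 0).ne', one_mul]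
  have ha : ∀ k, c (k + 1) * γs (k + 1) = min ((F (ω (k + 1)) (x (k + 1)) - Fstar (ω (k + 1)))
              / ‖gradient (F (ω (k + 1))) (x (k + 1))‖ ^ 2) (c k * γs k) := by
    intro k
    rw [hγs, ← mul_assoc, mul_one_div_cancel (hcpos _).ne', one_mul]
  have hab : ∀ k, min (1 / (2 * L)) (c 0 * γb) ≤ c k * γs k ∧ c k * γs k ≤ c 0 * γb := by
    intro k
    induction k with
    | zero => rw [ha0]; exact ⟨min_le_min_right _ (hq 0), min_le_right _ _⟩
    | succ k ih =>
      rw [ha]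
      exact ⟨le_min ((min_le_left _ _).trans (hq _)) ih.1, (min_le_right _ _).trans ih.2⟩
  have hm : 0 < min (1 / (2 * L)) (c 0 * γb) :=
    lt_min (by positivity) (mul_pos (hcpos 0) hγb)
  refine ⟨fun k => ⟨?_, ?_⟩, ?_, fun k => ?_⟩
  · have hc := hcpos k
    have e : min (1 / (2 * c k * L)) (c 0 * γb / c k) = min (1 / (2 * L)) (c 0 * γb) / c k := by
      rw [← min_div_div_right hc.le]
      congr 1
      field_simp
    rw [e, div_le_iff₀ hc, mul_comm (γs k)]
    exact (hab k).1
  · rw [le_div_iff₀ (hcpos k), mul_comm]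
    exact (hab k).2
  · exact le_of_mul_le_mul_left (hab 0).2 (hcpos 0)
  · have h1 : c (k + 1) * γs (k + 1) ≤ c k * γs k := by rw [ha]; exact min_le_right _ _
    have h2 : 0 < γs k := pos_of_mul_pos_right (hm.trans_le (hab k).1) (hcpos k).le
    have h3 := mul_le_mul_of_nonneg_right (hcmono (Nat.le_succ k)) h2.le
    exact le_of_mul_le_mul_left (h1.trans h3) (hcpos (k + 1))
end
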